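/- arXiv:1512.07479 — 6 statements merged into one kernel-verified Lean document; each statement's English description precedes it below -/
import Mathlib

section
/- Let κ be an infinite cardinal and let X be a topological space in which every point-finite family of nonempty functionally open sets has cardinality at most κ. Let T be a set, let Y ⊆ ℝ^T be a compact subspace (with the product topology), let B = {y ∈ Y : |supp y| ≤ κ}, and assume Y is the closure of B. Then every separately continuous function f : X × Y → ℝ depends upon κ coordinates in the second variable; that is, there exists a set S ⊆ T with |S| ≤ κ such that f(x,y') = f(x,y'') for all x ∈ X and all y', y'' ∈ Y with y'|_S = y''|_S. -/
open Cardinal Set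

universe u v

/-- A subset `A` of a topological space is *functionally open* if `A = g⁻¹((0,1])`
for some continuous `g : X → [0,1]`. -/
def FunctionallyOpen {X : Type u} [TopologicalSpace X] (A : Set X) : Prop :=
  ∃ g : X → ℝ, Continuous g ∧ (∀ x, g x ∈ Set.Icc (0 : ℝ) 1) ∧ A = g ⁻¹' Set.Ioc (0 : ℝ) 1

/-- A family of sets is *point-finite* if every point belongs to only finitely many members. -/
def PointFinite {X : Type u} (𝒰 : Set (Set X)) : Prop :=
  ∀ x : X, {U ∈ 𝒰 | x ∈ U}.Finite

/-- The point-finite cellularity `p(X)`: the supremum of the cardinalities of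
point-finite families of nonempty open subsets of `X`. -/
noncomputable def pCell (X : Type u) [TopologicalSpace X] : Cardinal.{u} :=
  ⨆ 𝒰 : {𝒰 : Set (Set X) // (∀ U ∈ 𝒰, IsOpen U ∧ U.Nonempty) ∧ PointFinite 𝒰},
    Cardinal.mk ↥𝒰.1

/-- The cellularity `c(X)`: the supremum of the cardinalities of disjoint families of
nonempty open subsets of `X`. -/
noncomputable def cellularity (X : Type u) [TopologicalSpace X] : Cardinal.{u} :=
  ⨆ 𝒰 : {𝒰 : Set (Set X) // (∀ U ∈ 𝒰, IsOpen U ∧ U.Nonempty) ∧ 𝒰.PairwiseDisjoint id},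
    Cardinal.mk ↥𝒰.1

/-- The weight `w(X)`: the least infinite cardinality of a base of the topology of `X`. -/
noncomputable def tWeight (X : Type u) [TopologicalSpace X] : Cardinal.{u} :=
  ⨅ B : {B : Set (Set X) // TopologicalSpace.IsTopologicalBasis B},
    max Cardinal.aleph0 (Cardinal.mk ↥B.1)

/-- The density `d(X)`: the least infinite cardinality of a dense subset of `X`. -/
noncomputable def tDensity (X : Type u) [TopologicalSpace X] : Cardinal.{u} :=
  ⨅ D : {D : Set X // Dense D}, max Cardinal.aleph0 (Cardinal.mk ↥D.1)

/-- `C_p(X)`: the continuous real valued functions on `X`, as a subspace of `ℝ^X` with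
the product topology, i.e. with the topology of pointwise convergence. -/
def Cp (X : Type u) [TopologicalSpace X] : Set (X → ℝ) := {f | Continuous f}

/-- A compact space is *Valdivia* if it is homeomorphic to a compact subspace `Z ⊆ ℝ^T`
for some set `T` such that the countably supported elements of `Z` are dense in `Z`. -/
def IsValdivia (Y : Type u) [TopologicalSpace Y] : Prop :=
  CompactSpace Y ∧ ∃ (T : Type u) (Z : Set (T → ℝ)), IsCompact Z ∧
    Dense {z : ↥Z | Set.Countable {t : T | (z : T → ℝ) t ≠ 0}} ∧ Nonempty (Y ≃ₜ ↥Z)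

/-- A compact space is *Eberlein* if it is homeomorphic to a weakly compact subset of a
Banach space. -/
def IsEberlein (Y : Type u) [TopologicalSpace Y] : Prop :=
  CompactSpace Y ∧ ∃ (E : Type u) (_ : NormedAddCommGroup E) (_ : NormedSpace ℝ E)
    (_ : CompleteSpace E), ∃ K : Set (WeakSpace ℝ E), IsCompact K ∧ Nonempty (Y ≃ₜ ↥K)

theorem functionallyOpen_setOf_lt {X : Type u} [TopologicalSpace X] {h : X → ℝ}
    (hh : Continuous h) (ε : ℝ) : FunctionallyOpen {x | ε < h x} := by
  refine ⟨fun x => min 1 (max 0 (h x - ε)), by fun_prop, fun x => ⟨by positivity, by simp⟩, ?_⟩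
  ext x
  simp

/-- A continuous real function on a compact subspace of `ℝ^T` is determined up to `ε` by
finitely many coordinates. -/
theorem exists_finite_forall_abs_sub_lt {T : Type u} {Y : Set (T → ℝ)} (hY : IsCompact Y)
    {g : ↥Y → ℝ} (hg : Continuous g) {ε : ℝ} (hε : 0 < ε) :
    ∃ F : Set T, F.Finite ∧ ∀ y z : ↥Y, (∀ t ∈ F, (y : T → ℝ) t = (z : T → ℝ) t) →
      |g y - g z| < ε := by
  have := isCompact_iff_compactSpace.mp hY
  have hu := CompactSpace.uniformContinuous_of_continuous hg
  have h1 := hu (Metric.dist_mem_uniformity hε)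
  rw [Filter.mem_map, uniformity_subtype, Pi.uniformity, Filter.mem_comap] at h1
  obtain ⟨s, hs, hsub⟩ := h1
  obtain ⟨I, hI, V, hV, -, hsV, -⟩ := Filter.mem_iInf'.mp hs
  refine ⟨I, hI, fun y z hyz => ?_⟩
  have : (y, z) ∈ (fun q : ↥Y × ↥Y => (q.1.1, q.2.1)) ⁻¹' s := by
    rw [hsV]
    simp only [mem_preimage, mem_iInter]
    intro i hi
    obtain ⟨W, hW, hWV⟩ := Filter.mem_comap.mp (hV i)
    apply hWV
    simp only [mem_preimage, hyz i hi]
    exact refl_mem_uniformity hW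
  simpa [Real.dist_eq] using hsub this

/-- If a point-finite indexed family of nonempty sets has at most `κ` distinct members, then
it has at most `κ` indices. -/
theorem mk_le_of_finite_setOf_mem {X ι : Type u} {κ : Cardinal.{u}} (hκ : ℵ₀ ≤ κ)
    {U : ι → Set X} (hne : ∀ i, (U i).Nonempty) (hfin : ∀ x, {i | x ∈ U i}.Finite)
    (hU : #(range U) ≤ κ) : #ι ≤ κ := by
  have h : (⋃ V : range U, U ⁻¹' {V.1}) = Set.univ := by
    ext i; simp
  rw [← mk_univ, ← h]
  refine (mk_iUnion_le_sum_mk).trans ((sum_le_sum _ (fun _ => ℵ₀) fun V => ?_).trans ?_)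
  · obtain ⟨V, i, rfl⟩ := V
    obtain ⟨x, hx⟩ := hne i
    have : (U ⁻¹' {U i}).Finite := (hfin x).subset fun j hj => by
      have hj : U j = U i := hj
      simpa [hj] using hx
    exact this.countable.le_aleph0
  · simpa using mul_le_of_le hκ hU hκ

theorem mk_iUnion_le_of_le {ι α : Type u} {κ : Cardinal.{u}} (hκ : ℵ₀ ≤ κ) {A : ι → Set α}
    (hι : #ι ≤ κ) (hA : ∀ i, #(A i) ≤ κ) : #(⋃ i, A i) ≤ κ := by
  refine (mk_iUnion_le_sum_mk).trans ((sum_le_sum _ (fun _ => κ) hA).trans ?_)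
  simpa using mul_le_of_le hκ hι le_rfl

theorem mk_iUnion_nat_le_of_le {α : Type u} {κ : Cardinal.{u}} (hκ : ℵ₀ ≤ κ) {A : ℕ → Set α}
    (hA : ∀ i, #(A i) ≤ κ) : #(⋃ i, A i) ≤ κ := by
  have : (⋃ i, A i) = ⋃ i : ULift.{u} ℕ, A i.down := by
    ext; simp
  rw [this]
  exact mk_iUnion_le_of_le hκ (by simpa using hκ) fun i => hA _

/-- A set of coordinates of size at most `κ` enlarges to one of size at most `κ` supporting
enough elements of the dense set `D` to approximate `closure D` on the original coordinates. -/
theorem exists_superset_approx {T : Type u} {κ : Cardinal.{u}} (hκ : ℵ₀ ≤ κ)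
    {D : Set (T → ℝ)} (hD : ∀ y ∈ D, #{t | y t ≠ 0} ≤ κ) (A : Set T) (hA : #A ≤ κ) :
    ∃ A' : Set T, A ⊆ A' ∧ #A' ≤ κ ∧ ∀ y ∈ closure D, ∀ F : Finset T, ↑F ⊆ A →
      ∀ u : T → Set ℝ, (∀ t ∈ F, IsOpen (u t) ∧ y t ∈ u t) →
        ∃ b ∈ D, (∀ t ∉ A', b t = 0) ∧ ∀ t ∈ F, b t ∈ u t := by
  classical
  let V := TopologicalSpace.countableBasis ℝ
  let P : Finset (A × V) → (T → ℝ) → Prop := fun i b => b ∈ D ∧ ∀ c ∈ i, b c.1 ∈ c.2.1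
  let b : Finset (A × V) → T → ℝ := fun i => if h : ∃ b, P i b then h.choose else 0
  have hb : ∀ i, (∃ b, P i b) → P i (b i) := fun i h => by
    simp only [b, dif_pos h]; exact h.choose_spec
  have hbκ : ∀ i, #{t | b i t ≠ 0} ≤ κ := fun i => by
    by_cases h : ∃ b, P i b
    · exact hD _ (hb i h).1
    · simp [b, dif_neg h]
  have hI : #(Finset (A × V)) ≤ κ := by
    have hV : Cardinal.lift.{u} #V ≤ ℵ₀ := by
      simp [V, (TopologicalSpace.countable_countableBasis ℝ).le_aleph0]
    have h : #(A × V) ≤ κ := by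
      rw [mk_prod]
      simpa using mul_le_of_le hκ hA (hV.trans hκ)
    rcases finite_or_infinite (A × V) with hf | hf
    · exact (mk_le_aleph0).trans hκ
    · rwa [mk_finset_of_infinite]
  refine ⟨A ∪ ⋃ i, {t | b i t ≠ 0}, subset_union_left, ?_, ?_⟩
  · exact (mk_union_le _ _).trans (add_le_of_le hκ hA (mk_iUnion_le_of_le hκ hI hbκ))
  intro y hy F hF u hu
  have hW : ∀ t : F, ∃ W ∈ V, y t ∈ W ∧ W ⊆ u t := fun t =>
    (TopologicalSpace.isBasis_countableBasis ℝ).exists_subset_of_mem_open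
      (hu t t.2).2 (hu t t.2).1
  choose W hWV hyW hWu using hW
  let i : Finset (A × V) := Finset.univ.image fun t : F => (⟨t, hF t.2⟩, ⟨W t, hWV t⟩)
  have hi : ∃ b, P i b := by
    have ho : IsOpen (⋂ t : F, {z : T → ℝ | z t ∈ W t}) := isOpen_iInter_of_finite fun t =>
      ((TopologicalSpace.isBasis_countableBasis ℝ).isOpen (hWV t)).preimage (continuous_apply _)
    obtain ⟨z, hz, hzD⟩ := mem_closure_iff.mp hy _ ho (by simpa using fun t ht => hyW ⟨t, ht⟩)
    rw [mem_iInter] at hz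
    refine ⟨z, hzD, fun c hc => ?_⟩
    obtain ⟨t, -, rfl⟩ := Finset.mem_image.mp hc
    exact hz t
  refine ⟨b i, (hb i hi).1, fun t ht => ?_, fun t ht => ?_⟩
  · by_contra h
    exact ht (Or.inr (mem_iUnion.mpr ⟨i, h⟩))
  · exact hWu ⟨t, ht⟩ ((hb i hi).2 _ (Finset.mem_image_of_mem _ (Finset.mem_univ (⟨t, ht⟩ : F))))

/-- Every set of at most `κ` coordinates is contained in a set `S` of at most `κ` coordinates
such that restriction to `S` retracts `closure D` into itself. -/
theorem exists_superset_indicator_mem {T : Type u} {κ : Cardinal.{u}} (hκ : ℵ₀ ≤ κ)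
    {D : Set (T → ℝ)} (hD : ∀ y ∈ D, #{t | y t ≠ 0} ≤ κ) (A : Set T) (hA : #A ≤ κ) :
    ∃ S : Set T, A ⊆ S ∧ #S ≤ κ ∧ ∀ y ∈ closure D, S.indicator y ∈ closure D := by
  choose! E hE1 hE2 hE3 using exists_superset_approx hκ hD
  let s : ℕ → Set T := fun n => E^[n] A
  have hs1 : ∀ n, s (n + 1) = E (s n) := fun n => Function.iterate_succ_apply' _ _ _
  have hsκ : ∀ n, #(s n) ≤ κ := fun n => by
    induction n with
    | zero => exact hA
    | succ n ih => rw [hs1]; exact hE2 _ ih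
  have hmono : Monotone s := monotone_nat_of_le_succ fun n => by
    rw [hs1]; exact hE1 _ (hsκ n)
  refine ⟨⋃ n, s n, subset_iUnion s 0, mk_iUnion_nat_le_of_le hκ hsκ, fun y hy => ?_⟩
  rw [mem_closure_iff]
  intro O hO hyO
  classical
  obtain ⟨F, u, hu, hFO⟩ := isOpen_pi_iff.mp hO _ hyO
  let G := F.filter (· ∈ ⋃ n, s n)
  have hG : (G : Set T) ⊆ ⋃ n, s n := fun t ht => (Finset.mem_filter.mp ht).2
  obtain ⟨n, hn⟩ := (Directed.exists_mem_subset_of_finset_subset_biUnion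
    hmono.directed_le hG)
  obtain ⟨b, hbD, hb0, hbu⟩ := hE3 _ (hsκ n) y hy G hn u fun t ht => by
    obtain ⟨h1, h2⟩ := Finset.mem_filter.mp ht
    have := hu t h1
    rwa [indicator_of_mem h2] at this
  refine ⟨b, hFO fun t ht => ?_, hbD⟩
  by_cases h : t ∈ ⋃ n, s n
  · exact hbu t (Finset.mem_filter.mpr ⟨ht, h⟩)
  · have h2 := (hu t ht).2
    rw [indicator_of_notMem h] at h2
    rw [hb0 t fun h' => h (mem_iUnion.mpr ⟨n + 1, by rwa [hs1]⟩)]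
    exact h2

/-- A family of pairs in `Y` with pairwise disjoint difference sets, all separated by more than
`ε` by some section of `f`, has at most `κ` members. -/
theorem mk_le_of_pairwise_disjoint_ne {X T : Type u} [TopologicalSpace X] {κ : Cardinal.{u}}
    (hκ : ℵ₀ ≤ κ)
    (hX : ∀ 𝒰 : Set (Set X), (∀ U ∈ 𝒰, U.Nonempty ∧ FunctionallyOpen U) → PointFinite 𝒰 →
      #𝒰 ≤ κ)
    {Y : Set (T → ℝ)} (hY : IsCompact Y) {f : X → ↥Y → ℝ}
    (hf1 : ∀ y : ↥Y, Continuous fun x : X => f x y) (hf2 : ∀ x : X, Continuous (f x))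
    {ε : ℝ} (hε : 0 < ε) {P : Set (↥Y × ↥Y)}
    (hPε : ∀ p ∈ P, ∃ x, ε < |f x p.1 - f x p.2|)
    (hP : P.Pairwise (Function.onFun Disjoint fun p => {t | p.1.1 t ≠ p.2.1 t})) : #P ≤ κ := by
  let U : P → Set X := fun p => {x | ε < |f x p.1.1 - f x p.1.2|}
  have hfin : ∀ x, {p | x ∈ U p}.Finite := fun x => by
    obtain ⟨F, hF, hFε⟩ := exists_finite_forall_abs_sub_lt hY (hf2 x) hε
    have h : ∀ p : P, x ∈ U p → ∃ t ∈ F, p.1.1.1 t ≠ p.1.2.1 t := fun p hp => by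
      by_contra! hc
      exact lt_asymm hp (hFε _ _ hc)
    rcases {p | x ∈ U p}.eq_empty_or_nonempty with h0 | ⟨p₀, hp₀⟩
    · simp [h0]
    have : Nonempty T := ⟨(h p₀ hp₀).choose⟩
    choose! t htF ht using h
    refine Set.Finite.of_finite_image (f := t) (hF.subset (image_subset_iff.mpr htF)) ?_
    intro p hp q hq hpq
    by_contra hne
    refine disjoint_left.mp (hP p.2 q.2 fun h => hne (Subtype.ext h)) (ht p hp) ?_
    rw [hpq]
    exact ht q hq
  have hne : ∀ p, (U p).Nonempty := fun p => hPε p p.2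
  refine mk_le_of_finite_setOf_mem hκ hne hfin (hX _ ?_ fun x => ?_)
  · rintro _ ⟨p, rfl⟩
    exact ⟨hne p, functionallyOpen_setOf_lt ((hf1 _).sub (hf1 _)).abs ε⟩
  · refine ((hfin x).image U).subset ?_
    rintro _ ⟨⟨p, rfl⟩, hx⟩
    exact ⟨p, hx, rfl⟩

/-- The values of `f` on pairs from `B` are determined up to `ε` by at most `κ` coordinates. -/
theorem exists_mk_le_forall_abs_sub_le {X T : Type u} [TopologicalSpace X] {κ : Cardinal.{u}}
    (hκ : ℵ₀ ≤ κ)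
    (hX : ∀ 𝒰 : Set (Set X), (∀ U ∈ 𝒰, U.Nonempty ∧ FunctionallyOpen U) → PointFinite 𝒰 →
      #𝒰 ≤ κ)
    {Y : Set (T → ℝ)} (hY : IsCompact Y) {B : Set ↥Y}
    (hB : ∀ y ∈ B, #{t : T | (y : T → ℝ) t ≠ 0} ≤ κ) {f : X → ↥Y → ℝ}
    (hf1 : ∀ y : ↥Y, Continuous fun x : X => f x y) (hf2 : ∀ x : X, Continuous (f x))
    {ε : ℝ} (hε : 0 < ε) :
    ∃ S : Set T, #S ≤ κ ∧ ∀ x, ∀ y ∈ B, ∀ z ∈ B,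
      (∀ t ∈ S, (y : T → ℝ) t = (z : T → ℝ) t) → |f x y - f x z| ≤ ε := by
  let d : ↥Y × ↥Y → Set T := fun p => {t | p.1.1 t ≠ p.2.1 t}
  let Q : Set (↥Y × ↥Y) := {p | p.1 ∈ B ∧ p.2 ∈ B ∧ ∃ x, ε < |f x p.1 - f x p.2|}
  obtain ⟨P, hPmax⟩ := zorn_subset {P : Set (↥Y × ↥Y) |
      P ⊆ Q ∧ P.Pairwise (Function.onFun Disjoint d)} (by
    intro c hc hchain
    refine ⟨⋃₀ c, ⟨sUnion_subset fun P hP => (hc hP).1, ?_⟩, fun P hP => subset_sUnion_of_mem hP⟩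
    exact (pairwise_sUnion hchain.directedOn).mpr fun P hP => (hc hP).2)
  obtain ⟨hPQ, hPd⟩ := hPmax.prop
  refine ⟨⋃ p : P, d p, mk_iUnion_le_of_le hκ ?_ fun p => ?_, fun x y hy z hz hyz => ?_⟩
  · exact mk_le_of_pairwise_disjoint_ne hκ hX hY hf1 hf2 hε (fun p hp => (hPQ hp).2.2) hPd
  · have h : d p ⊆ {t | p.1.1.1 t ≠ 0} ∪ {t | p.1.2.1 t ≠ 0} := fun t ht => by
      by_contra hc
      simp only [mem_union, mem_ofPred_eq, not_or, not_not] at hc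
      exact ht (hc.1.trans hc.2.symm)
    exact (mk_le_mk_of_subset h).trans ((mk_union_le _ _).trans
      (add_le_of_le hκ (hB _ (hPQ p.2).1) (hB _ (hPQ p.2).2.1)))
  · by_contra! hlt
    have hdisj : ∀ p ∈ P, Disjoint (d (y, z)) (d p) := fun p hp =>
      disjoint_left.mpr fun t ht htp => ht (hyz t (mem_iUnion.mpr ⟨⟨p, hp⟩, htp⟩))
    have hins : insert (y, z) P ⊆ P := hPmax.le_of_ge
      ⟨insert_subset ⟨hy, hz, x, hlt⟩ hPQ, hPd.insert fun p hp _ =>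
        ⟨hdisj p hp, (hdisj p hp).symm⟩⟩ (subset_insert _ _)
    have hself := hdisj _ (hins (mem_insert _ _))
    have heq : y = z := by
      ext t
      by_contra h
      exact disjoint_left.mp hself h h
    simp [heq] at hlt
    exact absurd hlt hε.not_gt

/-- Theorem 2.1: if every point-finite family of nonempty functionally open subsets of `X`
has cardinality at most `κ`, `Y ⊆ ℝ^T` is compact and is the closure of its set `B` of
elements with support of cardinality at most `κ`, then every separately continuous
`f : X × Y → ℝ` depends on at most `κ` coordinates in the second variable. -/
theorem stmt_0 {X T : Type u} [TopologicalSpace X] (κ : Cardinal.{u})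
    (hκ : Cardinal.aleph0 ≤ κ)
    (hX : ∀ 𝒰 : Set (Set X), (∀ U ∈ 𝒰, U.Nonempty ∧ FunctionallyOpen U) → PointFinite 𝒰 →
      Cardinal.mk ↥𝒰 ≤ κ)
    (Y : Set (T → ℝ)) (hYc : IsCompact Y)
    (B : Set ↥Y) (hB : B = {y : ↥Y | Cardinal.mk ↥{t : T | (y : T → ℝ) t ≠ 0} ≤ κ})
    (hYB : closure (Subtype.val '' B) = Y)
    (f : X → ↥Y → ℝ)
    (hf1 : ∀ y : ↥Y, Continuous fun x : X => f x y) (hf2 : ∀ x : X, Continuous (f x)) :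
    ∃ S : Set T, Cardinal.mk ↥S ≤ κ ∧ ∀ (x : X) (y' y'' : ↥Y),
      (∀ t ∈ S, (y' : T → ℝ) t = (y'' : T → ℝ) t) → f x y' = f x y'' := by
  obtain rfl := hB
  set B : Set ↥Y := {y : ↥Y | #{t : T | (y : T → ℝ) t ≠ 0} ≤ κ}
  choose A hAκ hA using fun n : ℕ => exists_mk_le_forall_abs_sub_le hκ hX hYc
    (B := B) (fun y hy => hy) hf1 hf2 (Nat.one_div_pos_of_nat (α := ℝ) (n := n))
  obtain ⟨S, hAS, hSκ, hS⟩ := exists_superset_indicator_mem hκ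
    (D := Subtype.val '' B) (by rintro _ ⟨y, hy, rfl⟩; exact hy) (⋃ n, A n)
    (mk_iUnion_nat_le_of_le hκ hAκ)
  rw [hYB] at hS
  let r : ↥Y → ↥Y := fun y => ⟨S.indicator y.1, hS y.1 y.2⟩
  have hr : Continuous r := by
    refine Continuous.subtype_mk (continuous_pi fun t => ?_) _
    by_cases ht : t ∈ S
    · have h : Continuous fun y : ↥Y => y.1 t :=
        (continuous_apply t).comp continuous_subtype_val
      simpa [ht] using h
    · simpa [ht] using continuous_const
  have hdense : Dense B := fun y => by
    rw [closure_subtype, hYB]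
    exact y.2
  have hfr : ∀ x y, f x y = f x (r y) := fun x => by
    refine congrFun (Continuous.ext_on hdense (hf2 x) ((hf2 x).comp hr) fun y hy => ?_)
    have hry : r y ∈ B := (mk_le_mk_of_subset fun t (ht : S.indicator y.1 t ≠ 0) =>
      show y.1 t ≠ 0 from fun h => ht (indicator_apply_eq_zero.mpr fun _ => h)).trans hy
    refine eq_of_abs_sub_nonpos (ge_of_tendsto' tendsto_one_div_add_atTop_nhds_zero_nat fun n => ?_)
    refine hA n x y hy _ hry fun t ht => ?_
    exact (indicator_of_mem (hAS (mem_iUnion.mpr ⟨n, ht⟩)) _).symm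
  refine ⟨S, hSκ, fun x y z hyz => ?_⟩
  rw [hfr x y, hfr x z]
  congr 1
  exact Subtype.ext (indicator_congr hyz)
end

section
/- Let κ be an infinite cardinal, let T be a set, let Y ⊆ ℝ^T be a compact subspace (with the product topology), and let B ⊆ Y be a dense subset that is κ-compact, i.e., the closure in Y of any subset A ⊆ B with |A| ≤ κ is a compact subset of B. Then for every set S ⊆ T with |S| ≤ κ, the images of Y and of B under the restriction map y ↦ y|_S coincide: {y|_S : y ∈ Y} = {b|_S : b ∈ B}. -/
open Cardinal Set

universe u v

theorem Cardinal.mk_finset_prod_nat_le {α : Type u} {κ : Cardinal.{u}} (hκ : ℵ₀ ≤ κ)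
    (hα : #α ≤ κ) : #(Finset α × ℕ) ≤ κ := by
  classical
  have hF : #(Finset α) ≤ κ :=
    (mk_le_of_surjective (f := (List.toFinset : List α → Finset α))
      List.toFinset_surjective).trans ((mk_list_le_max α).trans (max_le hκ hα))
  rw [mk_prod]
  simpa using mul_le_of_le hκ hF hκ

/-- A dense set approximates any point of `Y` on every finite set of coordinates. -/
theorem Dense.exists_forall_dist_coord_lt {T : Type u} {Y : Set (T → ℝ)} {B : Set ↥Y}
    (hB : Dense B) (y : ↥Y) {S : Set T} (F : Finset ↥S) {ε : ℝ} (hε : 0 < ε) :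
    ∃ b ∈ B, ∀ s ∈ F, dist ((b : T → ℝ) s) ((y : T → ℝ) s) < ε := by
  have hopen : IsOpen (⋂ s ∈ F, {z : ↥Y | dist ((z : T → ℝ) s) ((y : T → ℝ) s) < ε}) :=
    isOpen_biInter_finset fun s _ => isOpen_lt
      (((continuous_apply (s : T)).comp continuous_subtype_val).dist continuous_const) continuous_const
  obtain ⟨b, hb, hbB⟩ := hB.exists_mem_open hopen ⟨y, by simp [hε]⟩
  exact ⟨b, hb, by simpa using hbB⟩

/-- If `Y ⊆ ℝ^T` is compact and `B ⊆ Y` is a dense `κ`-compact subset, then for every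
`S ⊆ T` with `|S| ≤ κ`, the restriction map `y ↦ y|_S` has the same image on `Y` as
on `B`. -/
theorem stmt_2 {T : Type u} (κ : Cardinal.{u}) (hκ : Cardinal.aleph0 ≤ κ)
    (Y : Set (T → ℝ)) (hYc : IsCompact Y)
    (B : Set ↥Y) (hBdense : Dense B)
    (hBκ : ∀ A : Set ↥Y, A ⊆ B → Cardinal.mk ↥A ≤ κ →
      IsCompact (closure A) ∧ closure A ⊆ B) :
    ∀ S : Set T, Cardinal.mk ↥S ≤ κ →
      (fun y : ↥Y => S.restrict (y : T → ℝ)) '' Set.univ =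
        (fun y : ↥Y => S.restrict (y : T → ℝ)) '' B := by
  classical
  intro S hS
  refine Subset.antisymm ?_ (image_mono (subset_univ B))
  rintro _ ⟨y, -, rfl⟩
  choose b hbB hb using fun p : Finset ↥S × ℕ =>
    hBdense.exists_forall_dist_coord_lt y p.1 (Nat.one_div_pos_of_nat (α := ℝ) (n := p.2))
  obtain ⟨hcomp, hsub⟩ := hBκ (range b) (range_subset_iff.2 hbB)
    (mk_range_le.trans (mk_finset_prod_nat_le hκ hS))
  refine image_mono hsub ?_
  have hcont : Continuous fun z : ↥Y => S.restrict (z : T → ℝ) :=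
    continuous_pi fun s => (continuous_apply (s : T)).comp continuous_subtype_val
  refine (hcomp.image hcont).isClosed.mem_of_tendsto (b := Filter.atTop)
    (f := fun p => S.restrict (b p : T → ℝ)) (tendsto_pi_nhds.2 fun s => ?_)
    (Filter.Eventually.of_forall fun p => mem_image_of_mem _ (subset_closure (mem_range_self p)))
  refine tendsto_iff_dist_tendsto_zero.2 (squeeze_zero' (g := fun p => 1 / ((p.2 : ℝ) + 1))
    (Filter.Eventually.of_forall fun _ => dist_nonneg) ?_ ?_)
  · filter_upwards [Filter.eventually_ge_atTop (({s}, 0) : Finset ↥S × ℕ)] with p hp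
    exact (hb p s (hp.1 (Finset.mem_singleton_self s))).le
  · rw [← Filter.prod_atTop_atTop_eq]
    exact tendsto_one_div_add_atTop_nhds_zero_nat.comp Filter.tendsto_snd
end

section
/- Let (X, <) be an infinite linearly ordered compact space (a compact space whose topology is the order topology of a linear order). Then w(X) = p(C_p(X)). -/
open Cardinal Set

universe u v

theorem exists_finite_coloring_of_continuous {X : Type u} [LinearOrder X] [TopologicalSpace X]
    [OrderTopology X] [CompactSpace X] {f : X → ℝ} (hf : Continuous f) {ε : ℝ} (hε : 0 < ε) :
    ∃ (t : Finset X) (π : X → t), ∀ x y z, π x = π y → z ∈ Icc x y →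
      |f z - f x| < ε ∧ |f y - f z| < ε := by
  have hU : ∀ x, ordConnectedComponent (f ⁻¹' Metric.ball (f x) (ε / 2)) x ∈ nhds x := fun x =>
    ordConnectedComponent_mem_nhds.2
      (hf.continuousAt.preimage_mem_nhds (Metric.ball_mem_nhds _ (half_pos hε)))
  obtain ⟨t, ht⟩ := CompactSpace.elim_nhds_subcover _ hU
  have hcov : ∀ x, ∃ i : t, x ∈ ordConnectedComponent (f ⁻¹' Metric.ball (f i) (ε / 2)) (i : X) := by
    intro x
    have hx : x ∈ (⊤ : Set X) := trivial
    rw [← ht] at hx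
    simp only [mem_iUnion] at hx
    obtain ⟨i, hi, hxi⟩ := hx
    exact ⟨⟨i, hi⟩, hxi⟩
  choose π hπ using hcov
  refine ⟨t, π, fun x y z hxy hz => ?_⟩
  have hx := hπ x
  have hy := hπ y
  rw [← hxy] at hy
  have hz' := ordConnectedComponent_subset (OrdConnected.out inferInstance hx hy hz)
  have hx' := ordConnectedComponent_subset hx
  have hy' := ordConnectedComponent_subset hy
  simp only [mem_preimage, Metric.mem_ball, Real.dist_eq, abs_lt] at hx' hy' hz'
  constructor <;> rw [abs_lt] <;> constructor <;> linarith

theorem mk_le_of_finite_fibers {I R : Type u} [Infinite I] (g : I → R)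
    (hg : ∀ r, (g ⁻¹' {r}).Finite) : #I ≤ #R := by
  by_contra! h
  rcases finite_or_infinite R with hR | hR
  · obtain ⟨r, hr⟩ := Finite.exists_infinite_fiber g
    exact (infinite_coe_iff.1 hr) (hg r)
  · obtain ⟨r, hr⟩ := Cardinal.exists_infinite_fiber g h
    exact (infinite_coe_iff.1 hr) (hg r)

theorem mk_le_pCell {Y I : Type u} [TopologicalSpace Y] [Infinite I] (U : I → Set Y)
    (hU : ∀ i, IsOpen (U i)) (hne : ∀ i, (U i).Nonempty)
    (hfin : ∀ y, {i | y ∈ U i}.Finite) : #I ≤ pCell Y := by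
  have hrange : #I ≤ #(range U) := by
    refine mk_le_of_finite_fibers (rangeFactorization U) ?_
    rintro ⟨_, i, rfl⟩
    obtain ⟨y, hy⟩ := hne i
    refine (hfin y).subset fun j hj => ?_
    have : U j = U i := congrArg Subtype.val hj
    rwa [mem_ofPred_eq, this]
  refine hrange.trans (le_ciSup (f := fun 𝒰 : {𝒰 : Set (Set Y) //
    (∀ U ∈ 𝒰, IsOpen U ∧ U.Nonempty) ∧ PointFinite 𝒰} => #𝒰.1) (bddAbove_of_small)
    ⟨range U, ?_, fun y => ?_⟩)
  · rintro _ ⟨i, rfl⟩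
    exact ⟨hU i, hne i⟩
  · refine ((hfin y).image U).subset ?_
    rintro _ ⟨⟨i, rfl⟩, hy⟩
    exact ⟨i, hy, rfl⟩

theorem pCell_le_of_dense {Y D : Type u} [TopologicalSpace Y] (d : D → Y) (hd : DenseRange d) :
    pCell Y ≤ max ℵ₀ #D := by
  refine ciSup_le' ?_
  rintro ⟨𝒰, hopen, hfin⟩
  have : ∀ U : 𝒰, ∃ i, d i ∈ U.1 := fun U => hd.exists_mem_open (hopen U U.2).1 (hopen U U.2).2
  choose g hg using this
  rcases finite_or_infinite 𝒰 with h | h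
  · exact (lt_aleph0_of_finite _).le.trans (le_max_left _ _)
  · refine (mk_le_of_finite_fibers g fun i => ?_).trans (le_max_right _ _)
    refine Finite.of_finite_image ((hfin (d i)).subset ?_) Subtype.val_injective.injOn
    rintro _ ⟨U, rfl, rfl⟩
    exact ⟨U.2, hg U⟩

theorem isOpen_Cp_abs_sub {X : Type u} [TopologicalSpace X] (a b : X) (ε : ℝ) : IsOpen {f : Cp X | ε < |f.1 b - f.1 a|} := by
  have h : ∀ x : X, Continuous fun f : Cp X => f.1 x := fun x =>
    (continuous_apply x).comp continuous_subtype_val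
  exact isOpen_lt continuous_const ((h b).sub (h a)).abs

theorem exists_denseRange_Cp {X : Type u} [TopologicalSpace X] {B : Set (Set X)}
    (hB : TopologicalSpace.IsTopologicalBasis B) :
    ∃ d : Finset (B × ℚ × ℚ) → Cp X, DenseRange d := by
  classical
  let P : Finset (B × ℚ × ℚ) → Cp X → Prop := fun s f =>
    ∀ t ∈ s, ∀ x ∈ t.1.1, f.1 x ∈ Ioo (t.2.1 : ℝ) t.2.2
  have zero : Cp X := ⟨fun _ => 0, continuous_const⟩
  refine ⟨fun s => if h : ∃ f, P s f then h.choose else zero, ?_⟩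
  rw [DenseRange, dense_iff_inter_open]
  rintro W hW ⟨g, hg⟩
  obtain ⟨V, hV, rfl⟩ := isOpen_induced_iff.1 hW
  obtain ⟨I, u, hu, huV⟩ := isOpen_pi_iff.1 hV g.1 hg
  have key : ∀ x : I, ∃ t : B × ℚ × ℚ, x.1 ∈ t.1.1 ∧ (∀ y ∈ t.1.1, g.1 y ∈ Ioo (t.2.1 : ℝ) t.2.2)
      ∧ Ioo (t.2.1 : ℝ) t.2.2 ⊆ u x := by
    rintro ⟨x, hx⟩
    obtain ⟨v, hv, hgv, hvu⟩ := Real.isTopologicalBasis_Ioo_rat.exists_subset_of_mem_open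
      (hu x hx).2 (hu x hx).1
    simp only [mem_iUnion] at hv
    obtain ⟨p, q, -, rfl⟩ := hv
    obtain ⟨b, hb, hxb, hbv⟩ := hB.exists_subset_of_mem_open (a := x)
      (u := g.1 ⁻¹' Ioo (p : ℝ) q) hgv (isOpen_Ioo.preimage g.2)
    exact ⟨⟨⟨b, hb⟩, p, q⟩, hxb, hbv, hvu⟩
  choose t hxt hgt htu using key
  have hex : ∃ f, P (Finset.univ.image t) f := by
    refine ⟨g, fun s hs => ?_⟩
    obtain ⟨x, -, rfl⟩ := Finset.mem_image.1 hs
    exact hgt x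
  refine ⟨_, ?_, Finset.univ.image t, rfl⟩
  simp only [dif_pos hex]
  refine huV fun x hx => htu ⟨x, hx⟩ (hex.choose_spec _ ?_ _ (hxt ⟨x, hx⟩))
  exact Finset.mem_image_of_mem _ (Finset.mem_univ _)

theorem pCell_Cp_le_tWeight (X : Type u) [TopologicalSpace X] : pCell (Cp X) ≤ tWeight X := by
  have : Nonempty {B : Set (Set X) // TopologicalSpace.IsTopologicalBasis B} :=
    ⟨⟨_, TopologicalSpace.isTopologicalBasis_opens⟩⟩
  refine le_ciInf ?_
  rintro ⟨B, hB⟩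
  obtain ⟨d, hd⟩ := exists_denseRange_Cp hB
  refine (pCell_le_of_dense d hd).trans (max_le (le_max_left _ _) ?_)
  rcases isEmpty_or_nonempty B with h | h
  · exact (mk_le_aleph0 (α := Finset (B × ℚ × ℚ))).trans (le_max_left _ _)
  · rw [mk_finset_of_infinite]
    simpa [mul_comm, or_comm] using mul_le_max ℵ₀ #B

theorem tWeight_le_of_generateFrom {X : Type u} [t : TopologicalSpace X] {G : Set (Set X)}
    (hG : t = TopologicalSpace.generateFrom G) : tWeight X ≤ max ℵ₀ #G := by
  have hB := TopologicalSpace.isTopologicalBasis_of_subbasis hG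
  refine (ciInf_le' (fun B : {B : Set (Set X) // TopologicalSpace.IsTopologicalBasis B} =>
    max ℵ₀ #B.1) ⟨_, hB⟩).trans (max_le (le_max_left _ _) ?_)
  have hsurj : #((fun f => ⋂₀ f) '' {f : Set (Set X) | f.Finite ∧ f ⊆ G}) ≤ #(Finset G) := by
    refine mk_le_of_surjective (f := fun s : Finset G =>
      ⟨⋂₀ (Subtype.val '' (s : Set G)), _, ⟨s.finite_toSet.image _, ?_⟩, rfl⟩) ?_
    · rintro _ ⟨x, -, rfl⟩
      exact x.2
    · rintro ⟨_, f, ⟨hf, hfG⟩, rfl⟩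
      refine ⟨(hf.preimage Subtype.val_injective.injOn).toFinset, Subtype.ext ?_⟩
      simp [image_preimage_eq_inter_range, inter_eq_left.2 hfG]
  refine hsurj.trans ?_
  rcases finite_or_infinite G with h | h
  · exact (mk_le_aleph0 (α := Finset G)).trans (le_max_left _ _)
  · exact (mk_finset_of_infinite G).le.trans (le_max_right _ _)

section LinearOrder

variable {X : Type u} [LinearOrder X]

/-- `S` separates the order on `X`: any two points are either strictly separated by a point
of `S` or form a jump with both endpoints in `S`. -/
def SeparatesOrder (S : Set X) : Prop :=
  ∀ a b : X, a < b → (∃ s ∈ S, a < s ∧ s < b) ∨ (a ⋖ b ∧ a ∈ S ∧ b ∈ S)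

theorem SeparatesOrder.infinite [Infinite X] {S : Set X} (hS : SeparatesOrder S) :
    S.Infinite := by
  intro hfin
  have := hfin.to_subtype
  refine not_injective_infinite_finite
    (fun x : X => {s : S | (s : X) ≤ x}) ?_
  have aux : ∀ a b : X, a < b → {s : S | (s : X) ≤ a} ≠ {s : S | (s : X) ≤ b} := by
    intro a b hab h
    obtain ⟨s, hs, has, hsb⟩ : ∃ s ∈ S, a < s ∧ s ≤ b := by
      rcases hS a b hab with ⟨s, hs, has, hsb⟩ | ⟨-, -, hb⟩
      exacts [⟨s, hs, has, hsb.le⟩, ⟨b, hb, hab, le_rfl⟩]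
    have hmem : (⟨s, hs⟩ : S) ∈ {s : S | (s : X) ≤ a} := h ▸ hsb
    exact has.not_ge hmem
  intro a b h
  rcases lt_trichotomy a b with hlt | heq | hlt
  exacts [(aux a b hlt h).elim, heq, (aux b a hlt h.symm).elim]

theorem exists_separatesOrder (X : Type u) [LinearOrder X] : ∃ T : Set (X × X × X),
    (∀ t ∈ T, t.1 < t.2.1 ∧ t.2.1 < t.2.2) ∧
    (T.Pairwise fun t t' => t.2.1 ∉ Ioo t'.1 t'.2.2 ∨ t'.2.1 ∉ Ioo t.1 t.2.2) ∧
    SeparatesOrder ((fun t => t.2.1) '' T ∪ ({a : X | ∃ b, a ⋖ b} ∪ {b : X | ∃ a, a ⋖ b})) := by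
  obtain ⟨T, hT⟩ := zorn_subset {T : Set (X × X × X) |
      (∀ t ∈ T, t.1 < t.2.1 ∧ t.2.1 < t.2.2) ∧
      (T.Pairwise fun t t' => t.2.1 ∉ Ioo t'.1 t'.2.2 ∨ t'.2.1 ∉ Ioo t.1 t.2.2)} (by
    intro C hC hchain
    refine ⟨⋃₀ C, ⟨?_, (pairwise_sUnion hchain.directedOn).2 fun T hT => (hC hT).2⟩,
      fun _ => subset_sUnion_of_mem⟩
    rintro t ⟨T, hT, ht⟩
    exact (hC hT).1 t ht)
  refine ⟨T, hT.prop.1, hT.prop.2, fun a b hab => ?_⟩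
  by_cases hcov : a ⋖ b
  · exact Or.inr ⟨hcov, Or.inr (Or.inl ⟨b, hcov⟩), Or.inr (Or.inr ⟨a, hcov⟩)⟩
  · left
    by_contra! hno
    obtain ⟨c, hac, hcb⟩ := (not_covBy_iff hab).1 hcov
    have hnot : ∀ t ∈ T, t.2.1 ∉ Ioo a b := fun t ht h =>
      (hno _ (Or.inl ⟨t, ht, rfl⟩) h.1).not_gt h.2
    have hmem : (a, c, b) ∈ T := by
      refine hT.le_of_ge (y := insert (a, c, b) T) ⟨?_, ?_⟩ (subset_insert _ _) (mem_insert _ _)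
      · rintro t (rfl | ht)
        exacts [⟨hac, hcb⟩, hT.prop.1 t ht]
      · exact hT.prop.2.insert fun t ht _ => ⟨Or.inr (hnot t ht), Or.inl (hnot t ht)⟩
    exact hnot _ hmem ⟨hac, hcb⟩

theorem SeparatesOrder.tWeight_le [TopologicalSpace X] [OrderTopology X] [Infinite X] {S : Set X}
    (hS : SeparatesOrder S) : tWeight X ≤ #S := by
  have hinf : ℵ₀ ≤ #S := by
    have := hS.infinite.to_subtype
    exact aleph0_le_mk S
  have hG : ‹TopologicalSpace X› =
      TopologicalSpace.generateFrom (Ioi '' S ∪ Iio '' S) := by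
    refine le_antisymm (le_generateFrom ?_) ?_
    · rintro _ (⟨s, -, rfl⟩ | ⟨s, -, rfl⟩)
      exacts [isOpen_Ioi, isOpen_Iio]
    · rw [OrderTopology.topology_eq_generate_intervals (α := X)]
      refine le_generateFrom ?_
      let _ := TopologicalSpace.generateFrom (Ioi '' S ∪ Iio '' S)
      have hIoi : ∀ s ∈ S, IsOpen (Ioi s) := fun s hs =>
        TopologicalSpace.isOpen_generateFrom_of_mem (Or.inl ⟨s, hs, rfl⟩)
      have hIio : ∀ s ∈ S, IsOpen (Iio s) := fun s hs =>
        TopologicalSpace.isOpen_generateFrom_of_mem (Or.inr ⟨s, hs, rfl⟩)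
      rintro _ ⟨a, rfl | rfl⟩
      · refine isOpen_iff_forall_mem_open.2 fun x hx => ?_
        rcases hS a x hx with ⟨s, hs, has, hsx⟩ | ⟨-, ha, -⟩
        · exact ⟨Ioi s, Ioi_subset_Ioi has.le, hIoi s hs, hsx⟩
        · exact ⟨_, Subset.rfl, hIoi a ha, hx⟩
      · refine isOpen_iff_forall_mem_open.2 fun x hx => ?_
        rcases hS x a hx with ⟨s, hs, hxs, hsa⟩ | ⟨-, -, ha⟩
        · exact ⟨Iio s, Iio_subset_Iio hsa.le, hIio s hs, hxs⟩
        · exact ⟨_, Subset.rfl, hIio a ha, hx⟩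
  refine (tWeight_le_of_generateFrom hG).trans (max_le hinf ?_)
  refine (mk_union_le _ _).trans (add_le_of_le hinf mk_image_le mk_image_le)

variable [TopologicalSpace X] [OrderTopology X] [CompactSpace X]

theorem mk_covBy_le_pCell {J : Set X} [Infinite J] (hJ : ∀ a ∈ J, ∃ b, a ⋖ b) :
    #J ≤ pCell (Cp X) := by
  choose b hb using fun a : J => hJ a a.2
  refine mk_le_pCell (fun a : J => {f : Cp X | 1 / 2 < |f.1 (b a) - f.1 a|})
    (fun a => isOpen_Cp_abs_sub _ _ _) (fun a => ?_) (fun f => ?_)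
  · obtain ⟨f, hf0, hf1, -⟩ := exists_continuous_zero_one_of_isClosed
      (isClosed_singleton (x := (a : X))) (isClosed_singleton (x := b a))
      (disjoint_singleton.2 (hb a).lt.ne)
    refine ⟨⟨f, f.continuous⟩, ?_⟩
    have h0 : f a = 0 := hf0 rfl
    have h1 : f (b a) = 1 := hf1 rfl
    simp only [mem_ofPred_eq, h0, h1]
    norm_num
  · obtain ⟨t, π, hπ⟩ := exists_finite_coloring_of_continuous f.2 (ε := 1 / 2) (by norm_num)
    refine Finite.of_injOn (f := fun a : J => π a) (t := univ) (fun _ _ => mem_univ _) ?_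
      finite_univ
    have aux : ∀ a a' : J, 1 / 2 < |f.1 (b a) - f.1 a| → π a = π a' → ¬ a < a' :=
      fun a a' ha h hlt => ha.not_gt (hπ a a' (b a) h ⟨(hb a).le, (hb a).ge_of_gt hlt⟩).1
    intro a ha a' ha' h
    rcases lt_trichotomy a a' with hlt | heq | hlt
    exacts [(aux a a' ha h hlt).elim, heq, (aux a' a ha' h.symm hlt).elim]

theorem mk_triples_le_pCell {T : Set (X × X × X)} [Infinite T]
    (hT : ∀ t ∈ T, t.1 < t.2.1 ∧ t.2.1 < t.2.2)
    (hpair : T.Pairwise fun t t' => t.2.1 ∉ Ioo t'.1 t'.2.2 ∨ t'.2.1 ∉ Ioo t.1 t.2.2) :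
    #T ≤ pCell (Cp X) := by
  refine mk_le_pCell (fun t : T => {f : Cp X | 1 / 2 < |f.1 t.1.2.1 - f.1 t.1.1|} ∩
      {f : Cp X | 1 / 2 < |f.1 t.1.2.2 - f.1 t.1.2.1|})
    (fun t => (isOpen_Cp_abs_sub _ _ _).inter (isOpen_Cp_abs_sub _ _ _)) (fun t => ?_) (fun f => ?_)
  · obtain ⟨⟨a, c, b⟩, ht⟩ := t
    obtain ⟨hac, hcb⟩ := hT _ ht
    obtain ⟨f, hf0, hf1, -⟩ := exists_continuous_zero_one_of_isClosed
      (toFinite ({a, b} : Set X)).isClosed (isClosed_singleton (x := c))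
      (by simpa using ⟨hac.ne', hcb.ne⟩)
    refine ⟨⟨f, f.continuous⟩, ?_⟩
    have h0 : f a = 0 := hf0 (by simp)
    have h0' : f b = 0 := hf0 (by simp)
    have h1 : f c = 1 := hf1 rfl
    simp only [mem_inter_iff, mem_ofPred_eq, h0, h0', h1]
    norm_num
  · obtain ⟨p, π, hπ⟩ := exists_finite_coloring_of_continuous f.2 (ε := 1 / 2) (by norm_num)
    refine Finite.of_injOn (f := fun t : T => (π t.1.1, π t.1.2.2)) (t := univ)
      (fun _ _ => mem_univ _) ?_ finite_univ
    have aux : ∀ t t' : T, 1 / 2 < |f.1 t.1.2.1 - f.1 t.1.1| →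
        1 / 2 < |f.1 t.1.2.2 - f.1 t.1.2.1| → π t.1.1 = π t'.1.1 → π t.1.2.2 = π t'.1.2.2 →
        t.1.2.1 ∈ Ioo t'.1.1 t'.1.2.2 := by
      intro t t' h1 h2 ha hb
      obtain ⟨hac, hcb⟩ := hT _ t.2
      constructor
      · by_contra! hle
        exact h1.not_gt (hπ _ _ _ ha ⟨hac.le, hle⟩).1
      · by_contra! hle
        exact h2.not_gt (hπ _ _ _ hb.symm ⟨hle, hcb.le⟩).2
    intro t ht t' ht' h
    obtain ⟨ha, hb⟩ := Prod.ext_iff.1 h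
    by_contra hne
    rcases hpair t.2 t'.2 (fun h => hne (Subtype.ext h)) with h | h
    · exact h (aux t t' ht.1 ht.2 ha hb)
    · exact h (aux t' t ht'.1 ht'.2 ha.symm hb.symm)

theorem tWeight_le_pCell_Cp [Infinite X] : tWeight X ≤ pCell (Cp X) := by
  obtain ⟨T, hT, hpair, hsep⟩ := exists_separatesOrder X
  set J : Set X := {a | ∃ b, a ⋖ b}
  set J' : Set X := {b | ∃ a, a ⋖ b}
  have hJJ' : #J' ≤ #J := by
    choose g hg using fun b : J' => b.2
    refine mk_le_of_injective (f := fun b : J' => (⟨g b, b, hg b⟩ : J)) fun b b' h => ?_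
    have hgb : g b = g b' := congrArg Subtype.val h
    exact Subtype.ext ((hg b).unique_right (hgb ▸ hg b'))
  have hTp : T.Infinite → #T ≤ pCell (Cp X) := fun h => by
    have := h.to_subtype
    exact mk_triples_le_pCell hT hpair
  have hJp : J.Infinite → #J ≤ pCell (Cp X) := fun h => by
    have := h.to_subtype
    exact mk_covBy_le_pCell fun a ha => ha
  have hp : ℵ₀ ≤ pCell (Cp X) := by
    by_contra hp
    have hTf : T.Finite := not_infinite.1 fun h => hp ((infinite_iff.1 h.to_subtype).trans (hTp h))
    have hJf : J.Finite := not_infinite.1 fun h => hp ((infinite_iff.1 h.to_subtype).trans (hJp h))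
    have hJf' : J'.Finite := lt_aleph0_iff_set_finite.1
      (hJJ'.trans_lt (lt_aleph0_iff_set_finite.2 hJf))
    exact hsep.infinite ((hTf.image _).union (hJf.union hJf'))
  have hle : ∀ {Z : Type u} {A : Set Z}, (A.Infinite → #A ≤ pCell (Cp X)) →
      #A ≤ pCell (Cp X) := fun {Z A} h => by
    by_cases hA : A.Infinite
    · exact h hA
    · exact (lt_aleph0_iff_set_finite.2 (not_infinite.1 hA)).le.trans hp
  refine hsep.tWeight_le.trans ((mk_union_le _ _).trans (add_le_of_le hp
    (mk_image_le.trans (hle hTp)) ((mk_union_le _ _).trans (add_le_of_le hp (hle hJp)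
    (hJJ'.trans (hle hJp))))))

end LinearOrder

/-- Theorem 4.3: for an infinite linearly ordered compact space `X`,
`w(X) = p(C_p(X))`. -/
theorem stmt_14 (X : Type u) [LinearOrder X] [TopologicalSpace X] [OrderTopology X]
    [CompactSpace X] [Infinite X] :
    tWeight X = pCell ↥(Cp X) :=
  le_antisymm tWeight_le_pCell_Cp (pCell_Cp_le_tWeight X)
end

section
/- Let κ be an infinite cardinal and let (X₀, <) be a linearly ordered compact space with at least two points and with no neighbor points (i.e., for all x < y in X₀ the interval (x,y) is nonempty), and suppose p(C_p(X₀)) ≤ κ. Then c(X₀²) ≤ κ, i.e., every disjoint family of nonempty open subsets of X₀ × X₀ has cardinality at most κ. -/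
open Cardinal Set

universe u v

open Filter Topology in
/-- If, along an infinite set of indices, a continuous function separates the endpoints of the sides
of boxes in the square of a compact densely ordered space, then two of the boxes share a point. -/
theorem exists_ne_mem_Ioo_prod_of_infinite {X : Type*} [LinearOrder X] [TopologicalSpace X]
    [OrderTopology X] [CompactSpace X] [DenselyOrdered X] {ι : Type*} {a b c d : ι → X}
    (hab : ∀ i, a i < b i) (hcd : ∀ i, c i < d i) {f : X → ℝ} (hf : Continuous f) {r s : ℝ}
    (hrs : r < s) {S : Set ι} (hS : S.Infinite)
    (hfS : ∀ i ∈ S, f (a i) < r ∧ f (c i) < r ∧ s < f (b i) ∧ s < f (d i)) :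
    ∃ i j, i ≠ j ∧ ∃ p : X × X,
      p ∈ Ioo (a i) (b i) ×ˢ Ioo (c i) (d i) ∧ p ∈ Ioo (a j) (b j) ×ˢ Ioo (c j) (d j) := by
  have : Infinite S := hS.to_subtype
  let F : Ultrafilter S := hyperfilter S
  have hlim (g : ι → X) : ∃ x, Tendsto (fun i : S => g i) F (𝓝 x) := by
    obtain ⟨x, -, hx⟩ := isCompact_univ.ultrafilter_le_nhds (F.map fun i : S => g i) (by simp)
    exact ⟨x, hx⟩
  have hsep (g h : ι → X) (hgh : ∀ i, g i < h i) (hg : ∀ i ∈ S, f (g i) < r)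
      (hh : ∀ i ∈ S, s < f (h i)) : ∃ m, ∀ᶠ i : S in F, m ∈ Ioo (g i) (h i) := by
    obtain ⟨x, hx⟩ := hlim g
    obtain ⟨y, hy⟩ := hlim h
    have hxy : x ≤ y := le_of_tendsto_of_tendsto' hx hy fun i => (hgh i).le
    have hfx : f x ≤ r :=
      le_of_tendsto' ((hf.tendsto x).comp hx) fun i : S => (hg i i.2).le
    have hfy : s ≤ f y :=
      ge_of_tendsto' ((hf.tendsto y).comp hy) fun i : S => (hh i i.2).le
    have hne : x ≠ y := by
      rintro rfl
      linarith
    obtain ⟨m, hxm, hmy⟩ := exists_between (lt_of_le_of_ne hxy hne)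
    exact ⟨m, (hx.eventually_lt_const hxm).and (hy.eventually_const_lt hmy)⟩
  obtain ⟨m, hm⟩ := hsep a b hab (fun i hi => (hfS i hi).1) fun i hi => (hfS i hi).2.2.1
  obtain ⟨n, hn⟩ := hsep c d hcd (fun i hi => (hfS i hi).2.1) fun i hi => (hfS i hi).2.2.2
  have hmn := hm.and hn
  obtain ⟨i, hi⟩ := hmn.exists
  have hne : ∀ᶠ j : S in F, j ≠ i :=
    hyperfilter_le_cofinite (Set.finite_singleton i).compl_mem_cofinite
  obtain ⟨j, hj, hji⟩ := (hmn.and hne).exists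
  exact ⟨i, j, fun h => hji (Subtype.ext h.symm), (m, n), hi, hj⟩

/-- A nonempty open subset of the square of a densely ordered space contains a box such that no left
endpoint of a side is a right endpoint of a side. -/
theorem exists_Ioo_prod_subset_of_isOpen {X : Type*} [LinearOrder X] [TopologicalSpace X]
    [OrderTopology X] [DenselyOrdered X] [Nontrivial X] {U : Set (X × X)} (hU : IsOpen U)
    (hne : U.Nonempty) :
    ∃ a b c d : X, a < b ∧ c < d ∧ a ≠ d ∧ c ≠ b ∧ Ioo a b ×ˢ Ioo c d ⊆ U := by
  obtain ⟨⟨x, y⟩, hxy⟩ := hne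
  obtain ⟨V, W, hV, hW, hxV, hyW, hVW⟩ := isOpen_prod_iff.1 hU x y hxy
  obtain ⟨a, b, hab, habV⟩ := hV.exists_Ioo_subset ⟨x, hxV⟩
  obtain ⟨p, q, hpq, hpqW⟩ := hW.exists_Ioo_subset ⟨y, hyW⟩
  obtain ⟨c, ⟨hpc, hcq⟩, hcb⟩ := (Ioo_infinite hpq).exists_notMem_finite (finite_singleton b)
  obtain ⟨d, ⟨hcd, hdq⟩, hda⟩ := (Ioo_infinite hcq).exists_notMem_finite (finite_singleton a)
  exact ⟨a, b, c, d, hab, hcd, fun h => hda h.symm, hcb,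
    (prod_mono habV ((Ioo_subset_Ioo hpc.le hdq.le).trans hpqW)).trans hVW⟩

/-- A family of nonempty open sets, indexed so that every point lies in the sets of only finitely
many indices, has at most `κ` indices if `κ` is infinite and bounds the point-finite cellularity. -/
theorem mk_le_of_pCell_le {Y ι : Type u} [TopologicalSpace Y] {κ : Cardinal.{u}}
    (hκ : Cardinal.aleph0 ≤ κ) (hp : pCell Y ≤ κ) {O : ι → Set Y} (hO : ∀ i, IsOpen (O i))
    (hne : ∀ i, (O i).Nonempty) (hfin : ∀ y, {i | y ∈ O i}.Finite) : Cardinal.mk ι ≤ κ := by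
  have hpf : PointFinite (range O) := fun y =>
    ((hfin y).image O).subset <| by
      rintro _ ⟨⟨i, rfl⟩, hi⟩
      exact ⟨i, hi, rfl⟩
  have hrange : Cardinal.mk (range O) ≤ κ := by
    refine le_trans ?_ hp
    exact le_ciSup (f := fun 𝒰 : {𝒰 : Set (Set Y) //
      (∀ U ∈ 𝒰, IsOpen U ∧ U.Nonempty) ∧ PointFinite 𝒰} => Cardinal.mk ↥𝒰.1)
      Cardinal.bddAbove_of_small
      ⟨range O, by rintro _ ⟨i, rfl⟩; exact ⟨hO i, hne i⟩, hpf⟩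
  have hfib (U : range O) : Cardinal.mk (rangeFactorization O ⁻¹' {U}) ≤ Cardinal.aleph0 := by
    obtain ⟨_, i, rfl⟩ := U
    obtain ⟨y, hy⟩ := hne i
    refine ((hfin y).subset fun j hj => ?_).countable.le_aleph0
    have hji : O j = O i := congrArg Subtype.val hj
    exact hji.ge hy
  calc Cardinal.mk ι ≤ Cardinal.mk (range O) * Cardinal.aleph0 :=
        Cardinal.mk_le_mk_mul_of_mk_preimage_le _ hfib
    _ ≤ κ * κ := mul_le_mul' hrange hκ
    _ = κ := Cardinal.mul_eq_self hκ

/-- Step in the proof of Theorem 4.3: if `X₀` is a linearly ordered compact space with at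
least two points and no neighbor points and `p(C_p(X₀)) ≤ κ`, then every disjoint family
of nonempty open subsets of `X₀ × X₀` has cardinality at most `κ`, i.e. `c(X₀²) ≤ κ`. -/
theorem stmt_17 (κ : Cardinal.{u}) (hκ : Cardinal.aleph0 ≤ κ)
    (X₀ : Type u) [LinearOrder X₀] [TopologicalSpace X₀] [OrderTopology X₀]
    [CompactSpace X₀] [Nontrivial X₀]
    (hnon : ∀ x y : X₀, x < y → (Set.Ioo x y).Nonempty)
    (hp : pCell ↥(Cp X₀) ≤ κ) :
    ∀ 𝒰 : Set (Set (X₀ × X₀)), (∀ U ∈ 𝒰, IsOpen U ∧ U.Nonempty) →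
      𝒰.PairwiseDisjoint id → Cardinal.mk ↥𝒰 ≤ κ := by
  intro 𝒰 hopen hdisj
  have : DenselyOrdered X₀ := ⟨hnon⟩
  choose a b c d hab hcd had hcb hsub using fun U : 𝒰 =>
    exists_Ioo_prod_subset_of_isOpen (hopen U U.2).1 (hopen U U.2).2
  let O (U : 𝒰) : Set (Cp X₀) := {f | f.1 (a U) < 1 / 3 ∧ f.1 (c U) < 1 / 3 ∧
    2 / 3 < f.1 (b U) ∧ 2 / 3 < f.1 (d U)}
  have heval (x : X₀) : Continuous fun f : Cp X₀ => f.1 x :=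
    (continuous_apply x).comp continuous_subtype_val
  refine mk_le_of_pCell_le hκ hp (O := O) (fun U => ?_) (fun U => ?_) fun f => ?_
  · exact (isOpen_lt (heval _) continuous_const).inter <|
      (isOpen_lt (heval _) continuous_const).inter <|
      (isOpen_lt continuous_const (heval _)).inter (isOpen_lt continuous_const (heval _))
  · have hdis : Disjoint ({a U, c U} : Set X₀) {b U, d U} := by
      simp [(hab U).ne', (hcd U).ne', (had U).symm, (hcb U).symm]
    obtain ⟨g, hg0, hg1, -⟩ := exists_continuous_zero_one_of_isClosed
      (Set.toFinite {a U, c U}).isClosed (Set.toFinite {b U, d U}).isClosed hdis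
    refine ⟨⟨g, g.continuous⟩, ?_⟩
    have h1 : g (a U) = 0 := hg0 (by simp)
    have h2 : g (c U) = 0 := hg0 (by simp)
    have h3 : g (b U) = 1 := hg1 (by simp)
    have h4 : g (d U) = 1 := hg1 (by simp)
    refine ⟨?_, ?_, ?_, ?_⟩ <;> norm_num [h1, h2, h3, h4]
  · by_contra hinf
    obtain ⟨U, V, hUV, p, hpU, hpV⟩ := exists_ne_mem_Ioo_prod_of_infinite hab hcd f.2
      (by norm_num : (1 / 3 : ℝ) < 2 / 3) hinf fun U hU => hU
    exact Set.disjoint_left.1 (hdisj U.2 V.2 fun h => hUV (Subtype.ext h))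
      (hsub U hpU) (hsub V hpV)
end

section
/- Let (X, <) be a linearly ordered compact space with no neighbor points (i.e., for all x < y in X the interval (x,y) is nonempty), and let f : X → ℝ be continuous. Then there exists a finite set K ⊆ X such that for all x, y ∈ X with x < y and |f(x) − f(y)| > 1, the interval (x,y) meets K, i.e., (x,y) ∩ K ≠ ∅. -/
open Cardinal Set

universe u v

/-- Step in the proof of Theorem 4.3: if `X` is a linearly ordered compact space with no
neighbor points and `f : X → ℝ` is continuous, then there is a finite set `K ⊆ X` such
that every interval `(x,y)` with `|f(x) - f(y)| > 1` meets `K`. -/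
theorem stmt_18 (X : Type u) [LinearOrder X] [TopologicalSpace X] [OrderTopology X]
    [CompactSpace X] (hnon : ∀ x y : X, x < y → (Set.Ioo x y).Nonempty)
    (f : X → ℝ) (hf : Continuous f) :
    ∃ K : Set X, K.Finite ∧
      ∀ x y : X, x < y → 1 < |f x - f y| → (Set.Ioo x y ∩ K).Nonempty := by
  have key : ∃ K : Set X, K.Finite ∧
      ∀ x ∈ (univ : Set X), ∀ y : X, x < y → 1 < |f x - f y| → (Set.Ioo x y ∩ K).Nonempty := by
    refine isCompact_univ.induction_on
      (p := fun s => ∃ K : Set X, K.Finite ∧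
        ∀ x ∈ s, ∀ y : X, x < y → 1 < |f x - f y| → (Set.Ioo x y ∩ K).Nonempty)
      ⟨∅, Set.finite_empty, by simp⟩ ?_ ?_ ?_
    · rintro s t hst ⟨K, hK, h⟩
      exact ⟨K, hK, fun x hx => h x (hst hx)⟩
    · rintro s t ⟨K, hK, hs⟩ ⟨L, hL, ht⟩
      refine ⟨K ∪ L, hK.union hL, ?_⟩
      rintro x (hx | hx) y hxy hfxy
      · exact (hs x hx y hxy hfxy).mono (inter_subset_inter_right _ subset_union_left)
      · exact (ht x hx y hxy hfxy).mono (inter_subset_inter_right _ subset_union_right)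
    · intro z _
      have hball : f ⁻¹' Metric.ball (f z) (1 / 2) ∈ nhds z :=
        hf.continuousAt (Metric.ball_mem_nhds _ (by norm_num))
      obtain ⟨b, c, hz, hbc, hsub⟩ := exists_Icc_mem_subset_of_mem_nhds hball
      have lt_of_bad : ∀ x ∈ Set.Icc b c, ∀ y, x < y → 1 < |f x - f y| → c < y := by
        intro x hx y hxy hfxy
        by_contra! hyc
        have hfx : |f x - f z| < 1 / 2 := hsub hx
        have hfy : |f y - f z| < 1 / 2 := hsub ⟨hx.1.trans hxy.le, hyc⟩
        rw [abs_lt] at hfx hfy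
        rcases lt_abs.mp hfxy with h | h <;> linarith
      rw [nhdsWithin_univ]
      rcases hz.2.lt_or_eq with hzc | rfl
      · refine ⟨Set.Icc b c ∩ Set.Iio c, Filter.inter_mem hbc (Iio_mem_nhds hzc), {c},
          Set.finite_singleton c, fun x hx y hxy hfxy => ?_⟩
        exact ⟨c, ⟨hx.2, lt_of_bad x hx.1 y hxy hfxy⟩, rfl⟩
      · refine ⟨Set.Icc b z, hbc, ∅, Set.finite_empty, fun x hx y hxy hfxy => ?_⟩
        obtain ⟨u, hu, hsubu⟩ :=
          exists_Ico_subset_of_mem_nhds hbc ⟨y, lt_of_bad x hx y hxy hfxy⟩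
        obtain ⟨w, hw⟩ := hnon z u hu
        exact absurd (hsubu ⟨hw.1.le, hw.2⟩).2 hw.1.not_ge
  obtain ⟨K, hK, h⟩ := key
  exact ⟨K, hK, fun x y => h x (mem_univ x) y⟩
end

section
/- Let Y be an infinite compact Hausdorff space. Then p(C_p(Y)) ≤ w(Y); in particular d(C_p(Y)) ≤ w(Y) and every point-finite family of nonempty open subsets of C_p(Y) has cardinality at most w(Y). -/
open Cardinal Set

universe u v

open TopologicalSpace in
/-- In a normal `T1` space with base `B` there is a family of continuous functions, indexed by
`B × B`, containing for every point `x` and every neighbourhood of `x` a function which is `1`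
at `x` and vanishes off the neighbourhood. -/
theorem exists_bump_family {Y : Type u} [TopologicalSpace Y] [NormalSpace Y] [T1Space Y]
    {B : Set (Set Y)} (hB : IsTopologicalBasis B) :
    ∃ φ : B × B → C(Y, ℝ), ∀ (x : Y) (W : Set Y), IsOpen W → x ∈ W →
      ∃ p, φ p x = 1 ∧ ∀ y ∉ W, φ p y = 0 := by
  classical
  have key : ∀ p : B × B, ∃ f : C(Y, ℝ), closure (p.1 : Set Y) ⊆ p.2 →
      (∀ x ∈ (p.1 : Set Y), f x = 1) ∧ ∀ y ∉ (p.2 : Set Y), f y = 0 := by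
    intro p
    by_cases h : closure (p.1 : Set Y) ⊆ p.2
    · obtain ⟨f, hf0, hf1, -⟩ := exists_continuous_zero_one_of_isClosed
        (hB.isOpen p.2.2).isClosed_compl isClosed_closure
        (disjoint_compl_left_iff_subset.2 h)
      exact ⟨f, fun _ => ⟨fun x hx => hf1 (subset_closure hx), fun y hy => hf0 hy⟩⟩
    · exact ⟨0, fun h' => absurd h' h⟩
  choose φ hφ using key
  refine ⟨φ, fun x W hW hx => ?_⟩
  obtain ⟨V, hVB, hxV, hVW⟩ := hB.exists_subset_of_mem_open hx hW
  obtain ⟨U, hUB, hxU, hUV⟩ := hB.exists_closure_subset ((hB.isOpen hVB).mem_nhds hxV)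
  obtain ⟨h1, h0⟩ := hφ (⟨U, hUB⟩, ⟨V, hVB⟩) hUV
  exact ⟨_, h1 x hxU, fun y hy => h0 y fun hyV => hy (hVW hyV)⟩

/-- If a family of continuous functions contains bump functions at every point with arbitrarily
small support, then its finite rational combinations are dense in `C_p(Y)`. -/
theorem dense_range_rat_combinations {Y : Type u} [TopologicalSpace Y] [T1Space Y] {ι : Type v}
    (φ : ι → C(Y, ℝ))
    (hφ : ∀ (x : Y) (W : Set Y), IsOpen W → x ∈ W → ∃ p, φ p x = 1 ∧ ∀ y ∉ W, φ p y = 0) :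
    Dense (Set.range fun l : List (ℚ × ι) =>
      (⟨(l.map fun a => (a.1 : ℝ) • φ a.2).sum, ContinuousMap.continuous _⟩ : ↥(Cp Y))) := by
  classical
  rw [dense_iff_inter_open]
  rintro O hO ⟨f, hf⟩
  obtain ⟨O', hO', rfl⟩ := isOpen_induced_iff.1 hO
  obtain ⟨F, u, hu, hFu⟩ := isOpen_pi_iff.1 hO' f.1 hf
  have hbump : ∀ x : Y, ∃ p, φ p x = 1 ∧ ∀ y ∈ F, y ≠ x → φ p y = 0 := by
    intro x
    obtain ⟨p, h1, h0⟩ := hφ x ((F.erase x : Finset Y) : Set Y)ᶜ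
      (Finset.finite_toSet _).isClosed.isOpen_compl (by simp)
    exact ⟨p, h1, fun y hy hne => h0 y (by simp [hy, hne])⟩
  choose p hp1 hp0 using hbump
  have hrat : ∀ x : Y, ∃ q : ℚ, x ∈ F → (q : ℝ) ∈ u x := by
    intro x
    by_cases hx : x ∈ F
    · exact (Rat.denseRange_cast.exists_mem_open (hu x hx).1 ⟨_, (hu x hx).2⟩).imp
        fun _ h _ => h
    · exact ⟨0, fun h => absurd h hx⟩
  choose q hq using hrat
  refine ⟨_, ?_, F.toList.map fun x => (q x, p x), rfl⟩
  refine hFu fun y hy => ?_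
  have hsum : (((F.toList.map fun x => (q x, p x)).map
      fun a => (a.1 : ℝ) • φ a.2).sum : C(Y, ℝ)) y = q y := by
    rw [List.map_map, Finset.sum_map_toList, ContinuousMap.sum_apply, Finset.sum_eq_single y]
    · simp [hp1]
    · intro x _ hxy
      simp [hp0 x y hy hxy.symm]
    · exact fun h => absurd hy h
  simpa only [hsum] using hq y hy

/-- The density of `C_p(Y)` does not exceed the weight of a normal `T1` space `Y`. -/
theorem tDensity_Cp_le_tWeight (Y : Type u) [TopologicalSpace Y] [NormalSpace Y] [T1Space Y] :
    tDensity ↥(Cp Y) ≤ tWeight Y := by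
  have : Nonempty {B : Set (Set Y) // TopologicalSpace.IsTopologicalBasis B} :=
    ⟨⟨_, TopologicalSpace.isTopologicalBasis_opens⟩⟩
  refine le_ciInf fun ⟨B, hB⟩ => ?_
  obtain ⟨φ, hφ⟩ := exists_bump_family hB
  refine (ciInf_le' _ ⟨_, dense_range_rat_combinations φ hφ⟩).trans
    (max_le (le_max_left _ _) (mk_range_le.trans ((mk_list_le_max _).trans ?_)))
  refine max_le (le_max_left _ _) ?_
  have hℵ : ℵ₀ ≤ max ℵ₀ #B := le_max_left _ _
  have hBB : #(B × B) ≤ max ℵ₀ #B := by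
    rw [mk_prod, lift_id]
    exact mul_le_of_le hℵ (le_max_right _ _) (le_max_right _ _)
  rw [mk_prod, lift_uzero]
  exact mul_le_of_le hℵ (by simp) (by simpa using hBB)

/-- A point-finite family of nonempty open sets has cardinality at most the density. -/
theorem PointFinite.mk_le_tDensity {X : Type u} [TopologicalSpace X] {𝒰 : Set (Set X)}
    (hfin : PointFinite 𝒰) (ho : ∀ U ∈ 𝒰, IsOpen U ∧ U.Nonempty) : #𝒰 ≤ tDensity X := by
  have : Nonempty {D : Set X // Dense D} := ⟨⟨_, dense_univ⟩⟩
  refine le_ciInf fun ⟨D, hD⟩ => ?_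
  have hmem : ∀ U : 𝒰, ∃ d : D, (d : X) ∈ (U : Set X) := fun U =>
    let ⟨x, hxU, hxD⟩ := hD.inter_open_nonempty U (ho U U.2).1 (ho U U.2).2
    ⟨⟨x, hxD⟩, hxU⟩
  choose d hd using hmem
  have hfib : ∀ x : D, #(d ⁻¹' {x}) ≤ ℵ₀ := by
    intro x
    have hx : (d ⁻¹' {x}).Finite := by
      refine Set.Finite.of_finite_image ((hfin x).subset ?_) Subtype.val_injective.injOn
      rintro _ ⟨U, rfl, rfl⟩
      exact ⟨U.2, hd U⟩
    exact hx.countable.le_aleph0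
  exact (mk_le_mk_mul_of_mk_preimage_le d hfib).trans
    (mul_le_of_le (le_max_left _ _) (le_max_right _ _) (le_max_left _ _))

/-- The point-finite cellularity does not exceed the density. -/
theorem pCell_le_tDensity (X : Type u) [TopologicalSpace X] : pCell X ≤ tDensity X :=
  ciSup_le' fun 𝒰 => 𝒰.2.2.mk_le_tDensity 𝒰.2.1

/-- For an infinite compact Hausdorff space `Y`, `p(C_p(Y)) ≤ w(Y)`; in particular
`d(C_p(Y)) ≤ w(Y)` and every point-finite family of nonempty open subsets of `C_p(Y)`
has cardinality at most `w(Y)`. -/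
theorem stmt_19 (Y : Type u) [TopologicalSpace Y] [CompactSpace Y] [T2Space Y]
    [Infinite Y] :
    pCell ↥(Cp Y) ≤ tWeight Y ∧ tDensity ↥(Cp Y) ≤ tWeight Y ∧
      ∀ 𝒰 : Set (Set ↥(Cp Y)), (∀ U ∈ 𝒰, IsOpen U ∧ U.Nonempty) → PointFinite 𝒰 →
        Cardinal.mk ↥𝒰 ≤ tWeight Y := by
  have hd := tDensity_Cp_le_tWeight Y
  exact ⟨(pCell_le_tDensity _).trans hd, hd, fun _ ho hfin => (hfin.mk_le_tDensity ho).trans hd⟩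
end
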